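/- Let k ≥ 2, n ≥ 1, and let w ∈ S_n be a word of type n and length ℓ over the alphabet {0,…,k−1}. If v is a subsequence of w in which any two consecutive letters are distinct (v satisfies List.Chain' (· ≠ ·)), then n·|v| ≤ ℓ + 2·n (i.e. |v| ≤ ℓ/n + 2; v has at most ⌈(ℓ−1)/n⌉ + 1 letters). -/

import Mathlib

/-- The block word `B(n) = 0^n 1^n ⋯ (k-1)^n` over the alphabet `{0, …, k-1}`. -/
def blockWord (k n : ℕ) : List ℕ := (List.range k).flatMap fun a => List.replicate n a

/-- A word `w` is of type `n` (written `w ∈ S_n`) if, for some `m`, it is an infix of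
`B(n)^m` or of the reversal of `B(n)^m`. -/
def IsTypeWord (k n : ℕ) (w : List ℕ) : Prop :=
  ∃ m : ℕ, w <:+: (List.replicate m (blockWord k n)).flatten ∨
    w <:+: (List.replicate m (blockWord k n)).flatten.reverse

/-- A subsequence of a constant word whose consecutive letters differ has at most one letter. -/
theorem length_le_one_of_isChain_ne_of_sublist_replicate {α : Type*} {a : α} {n : ℕ}
    {v : List α} (hv : v.Sublist (List.replicate n a)) (hchain : v.IsChain (· ≠ ·)) :
    v.length ≤ 1 := by
  obtain ⟨m, -, rfl⟩ := List.sublist_replicate_iff.mp hv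
  match m with
  | 0 | 1 => simp
  | m + 2 => simp [List.replicate_succ] at hchain

theorem mul_length_le_of_prefix_flatMap_replicate {α : Type*} {n : ℕ} (L : List α)
    {w v : List α} (hw : w <+: L.flatMap (List.replicate n)) (hv : v.Sublist w)
    (hchain : v.IsChain (· ≠ ·)) : n * v.length ≤ w.length + n := by
  induction L generalizing w v with
  | nil =>
    obtain rfl : w = [] := by simpa using hw
    simp [List.sublist_nil.mp hv]
  | cons a L ih =>
    rw [List.flatMap_cons] at hw
    obtain ⟨u, hu⟩ := hw
    rcases List.append_eq_append_iff.mp hu with ⟨s, hs, -⟩ | ⟨t, rfl, ht⟩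
    · have := length_le_one_of_isChain_ne_of_sublist_replicate
        (hv.trans (hs ▸ List.sublist_append_left w s)) hchain
      nlinarith
    · obtain ⟨v₁, v₂, rfl, h₁, h₂⟩ := List.sublist_append_iff.mp hv
      have := length_le_one_of_isChain_ne_of_sublist_replicate h₁ hchain.left_of_append
      have := ih ⟨u, ht.symm⟩ h₂ hchain.right_of_append
      simp only [List.length_append, List.length_replicate]
      nlinarith

theorem mul_length_le_of_infix_flatMap_replicate {α : Type*} {n : ℕ} (L : List α)
    {w v : List α} (hw : w <:+: L.flatMap (List.replicate n)) (hv : v.Sublist w)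
    (hchain : v.IsChain (· ≠ ·)) : n * v.length ≤ w.length + 2 * n := by
  induction L with
  | nil =>
    obtain rfl : w = [] := by simpa using hw
    simp [List.sublist_nil.mp hv]
  | cons a L ih =>
    rw [List.flatMap_cons] at hw
    rcases List.infix_append_iff.mp hw with hw | hw | ⟨s, t, rfl, hs, ht⟩
    · have := length_le_one_of_isChain_ne_of_sublist_replicate (hv.trans hw.sublist) hchain
      nlinarith
    · exact ih hw
    · obtain ⟨v₁, v₂, rfl, h₁, h₂⟩ := List.sublist_append_iff.mp hv
      have := length_le_one_of_isChain_ne_of_sublist_replicate (h₁.trans hs.sublist)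
        hchain.left_of_append
      have := mul_length_le_of_prefix_flatMap_replicate L ht h₂ hchain.right_of_append
      simp only [List.length_append]
      nlinarith

theorem flatten_replicate_blockWord (k n m : ℕ) :
    (List.replicate m (blockWord k n)).flatten =
      (List.replicate m (List.range k)).flatten.flatMap (List.replicate n) := by
  induction m with
  | zero => rfl
  | succ m ih => simp only [List.replicate_succ, List.flatten_cons, List.flatMap_append, ih]; rfl

/-- If `w ∈ S_n` has length `ℓ` and `v` is a subsequence of `w` whose
consecutive letters are pairwise distinct, then `n * |v| ≤ ℓ + 2 * n`
(i.e. `|v| ≤ ℓ/n + 2`). -/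
theorem chain_subseq_type_word_bound (k n ℓ : ℕ) (hk : 2 ≤ k) (hn : 1 ≤ n)
    (w v : List ℕ) (hw : IsTypeWord k n w) (hℓ : w.length = ℓ)
    (hv : v.Sublist w) (hchain : v.Chain' (· ≠ ·)) :
    n * v.length ≤ ℓ + 2 * n := by
  subst hℓ
  obtain ⟨m, hw | hw⟩ := hw
  · rw [flatten_replicate_blockWord] at hw
    exact mul_length_le_of_infix_flatMap_replicate _ hw hv hchain
  · have hrev : List.reverse ∘ List.replicate n = (List.replicate n : ℕ → List ℕ) := by
      funext a
      simp
    rw [flatten_replicate_blockWord, List.reverse_flatMap, hrev] at hw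
    exact mul_length_le_of_infix_flatMap_replicate _ hw hv hchain
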